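/- arXiv:2504.13753 — 5 statements merged into one kernel-verified Lean document; each statement's English description precedes it below -/
import Mathlib

section
/- For every natural number n, the absolute falling factorial satisfies [1/2]_n ≤ n! and n! ≤ 2 · 2^n · [1/2]_n. -/
/-- The absolute falling factorial `[1/2]_n`: `[1/2]_0 = 1`, and
`[1/2]_{n+1} = |n - 1/2| * [1/2]_n`, so that `[1/2]_1 = 1/2` and
`[1/2]_n = (1/2)·(1/2)·(3/2)···(n - 3/2)` for `n ≥ 2`. -/
noncomputable def gd : ℕ → ℝ
  | 0 => 1
  | n + 1 => |(n : ℝ) - 1 / 2| * gd n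

theorem gd_nonneg_aux (n : ℕ) : 0 ≤ gd n := by
  induction n with
  | zero => simp [gd]
  | succ n ih => rw [gd]; positivity

theorem gd_upper_aux (n : ℕ) : gd n ≤ (n.factorial : ℝ) := by
  induction n with
  | zero => simp [gd]
  | succ n ih =>
    rw [gd, Nat.factorial_succ]
    push_cast
    have h : |(n : ℝ) - 1 / 2| ≤ (n : ℝ) + 1 := by
      have : (0 : ℝ) ≤ n := Nat.cast_nonneg n
      rw [abs_le]
      constructor <;> linarith
    exact mul_le_mul h ih (gd_nonneg_aux n) (by positivity)

theorem gd_two_aux : gd 2 = 1 / 4 := by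
  have h : |(1 : ℝ) - 1 / 2| = 1 / 2 := by rw [abs_of_pos] <;> norm_num
  have hz : |(0 : ℝ) - 1 / 2| = 1 / 2 := by rw [abs_of_neg] <;> norm_num
  simp only [gd, Nat.cast_zero, Nat.cast_one, h, hz]
  norm_num

theorem gd_one_aux : gd 1 = 1 / 2 := by
  have hz : |(0 : ℝ) - 1 / 2| = 1 / 2 := by rw [abs_of_neg] <;> norm_num
  simp only [gd, Nat.cast_zero, hz]
  norm_num

theorem gd_lower_aux (n : ℕ) (hn : 2 ≤ n) : (n.factorial : ℝ) ≤ 2 * 2 ^ n * gd n := by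
  induction n, hn using Nat.le_induction with
  | base => rw [gd_two_aux]; norm_num [Nat.factorial]
  | succ n hn ih =>
    rw [gd, Nat.factorial_succ]
    push_cast
    have h2 : (2 : ℝ) ≤ n := by exact_mod_cast hn
    rw [abs_of_nonneg (by linarith)]
    have h : (n : ℝ) + 1 ≤ 2 * ((n : ℝ) - 1 / 2) := by linarith
    calc ((n : ℝ) + 1) * (n.factorial : ℝ)
        ≤ (2 * ((n : ℝ) - 1 / 2)) * (2 * 2 ^ n * gd n) :=
          mul_le_mul h ih (by positivity) (by linarith)
      _ = _ := by ring

theorem stmt0 (n : ℕ) :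
    gd n ≤ (n.factorial : ℝ) ∧ (n.factorial : ℝ) ≤ 2 * 2 ^ n * gd n := by
  refine ⟨gd_upper_aux n, ?_⟩
  match n with
  | 0 => norm_num [gd]
  | 1 => rw [gd_one_aux]; norm_num
  | n + 2 => exact gd_lower_aux (n + 2) (by omega)
end

section
/- For every multi-index ν, the sum over all multi-indices η with 0 < η < ν of (ν choose η) · [1/2]_{|η|} · [1/2]_{|ν−η|} is at most 2 · [1/2]_{|ν|}. -/
/-- The total degree `|ν| = Σ_j ν_j` of a multi-index. -/
def deg (ν : ℕ →₀ ℕ) : ℕ := ν.sum fun _ n => n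

/-- The multi-index binomial coefficient `(ν choose η) = Π_j (ν_j choose η_j)`. -/
def mchoose (ν η : ℕ →₀ ℕ) : ℕ := ∏ j ∈ ν.support ∪ η.support, (ν j).choose (η j)

theorem gd_cat (k : ℕ) : gd (k+1) = (k+1).factorial * 2 * catalan k / 4^(k+1) := by
  have key : ∀ k : ℕ, ((k:ℝ)+2) * catalan (k+1) = 2*(2*k+1) * catalan k := by
    intro k
    have h1 := succ_mul_catalan_eq_centralBinom k
    have h2 := succ_mul_catalan_eq_centralBinom (k+1)
    have h3 := Nat.succ_mul_centralBinom_succ k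
    rw [← h1, ← h2] at h3
    have h4 : ((k:ℝ)+1) * (((k:ℝ)+2) * catalan (k+1)) = ((k:ℝ)+1) * (2*(2*k+1) * catalan k) := by
      have : (((k+1) * ((k+1+1) * catalan (k+1)) : ℕ) : ℝ) = ((2*(2*k+1)*((k+1)*catalan k) : ℕ) : ℝ) := by
        rw [h3]
      push_cast at this
      linarith
    exact mul_left_cancel₀ (by positivity) h4
  induction k with
  | zero => norm_num [gd, abs_of_neg]
  | succ k ih =>
    rw [gd, ih, abs_of_nonneg (by push_cast; linarith [(Nat.cast_nonneg k : (0:ℝ) ≤ k)]),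
      Nat.factorial_succ (k+1)]
    have := key k
    push_cast
    field_simp
    have e : (4:ℝ)^(k+1+1) = 4 * 4^(k+1) := by ring
    try rw [e]
    linear_combination (-2 * 4 ^ (k+1) : ℝ) * this

theorem gd_nonneg (k : ℕ) : 0 ≤ gd k := by
  induction k with
  | zero => norm_num [gd]
  | succ k ih => rw [gd]; positivity

theorem gd_conv (m : ℕ) :
    ∑ k ∈ Finset.range (m+1), ((m+2).choose (k+1) : ℝ) * (gd (k+1) * gd (m-k+1)) = 2 * gd (m+2) := by
  rw [gd_cat (m+1), catalan_succ', Finset.Nat.sum_antidiagonal_eq_sum_range_succ_mk]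
  push_cast
  rw [Finset.mul_sum, Finset.sum_div, Finset.mul_sum]
  refine Finset.sum_congr rfl fun k hk => ?_
  have hk : k ≤ m := by simpa [Nat.lt_succ_iff] using hk
  obtain ⟨l, rfl⟩ := Nat.exists_eq_add_of_le hk
  have e : k + l - k = l := by omega
  rw [e, gd_cat, gd_cat]
  have h := Nat.choose_mul_factorial_mul_factorial (show k + 1 ≤ k + l + 2 by omega)
  have e2 : k + l + 2 - (k + 1) = l + 1 := by omega
  rw [e2] at h
  have h' : ((k+l+2).choose (k+1) : ℝ) * (k+1).factorial * (l+1).factorial = (k+l+2).factorial := by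
    exact_mod_cast h
  have e3 : k + l + 1 + 1 = k + l + 2 := rfl
  rw [e3, ← h']
  field_simp
  ring

open Polynomial in
theorem mvander (ν : ℕ →₀ ℕ) :
    ∑ η ∈ Finset.Icc 0 ν, (mchoose ν η : ℝ[X]) * X ^ (deg η) = (X + 1) ^ (deg ν) := by
  have h1 : (X + 1 : ℝ[X]) ^ (deg ν) = ∏ j ∈ ν.support, ∑ i ∈ Finset.Icc 0 (ν j),
      ((ν j).choose i : ℝ[X]) * X ^ i := by
    rw [deg, Finsupp.sum, ← Finset.prod_pow_eq_pow_sum]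
    refine Finset.prod_congr rfl fun j _ => ?_
    rw [add_pow, Finset.range_eq_Ico, Finset.Ico_add_one_right_eq_Icc]
    refine Finset.sum_congr rfl fun i _ => ?_
    rw [one_pow]; ring
  rw [h1, Finset.prod_sum]
  symm
  refine Finset.sum_bij' (fun p _ => Finsupp.indicator ν.support p) (fun η _ j _ => η j) ?_ ?_ ?_ ?_ ?_
  · intro p hp
    simp only [Finset.mem_pi, Finset.mem_Icc] at hp ⊢
    refine ⟨zero_le, fun j => ?_⟩
    by_cases hj : j ∈ ν.support
    · rw [Finsupp.indicator_of_mem hj]; exact (hp j hj).2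
    · rw [Finsupp.indicator_of_notMem hj]; exact Nat.zero_le _
  · intro η hη
    simp only [Finset.mem_pi, Finset.mem_Icc] at hη ⊢
    exact fun j _ => ⟨Nat.zero_le _, hη.2 j⟩
  · intro p hp
    funext j hj
    exact Finsupp.indicator_of_mem hj _
  · intro η hη
    ext j
    by_cases hj : j ∈ ν.support
    · exact Finsupp.indicator_of_mem hj _
    · rw [Finsupp.indicator_of_notMem hj]
      have := (Finset.mem_Icc.1 hη).2 j
      rw [Finsupp.notMem_support_iff.1 hj] at this
      omega
  · intro p hp
    have hs : (Finsupp.indicator ν.support p).support ⊆ ν.support := Finsupp.support_indicator_subset _ _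
    rw [mchoose, Finset.union_eq_left.2 hs, deg, Finsupp.sum_of_support_subset _ hs _ (by simp),
      ← Finset.prod_pow_eq_pow_sum]
    push_cast
    rw [← Finset.prod_mul_distrib, ← Finset.prod_attach ν.support]
    refine Finset.prod_congr rfl fun j _ => ?_
    rw [Finsupp.indicator_of_mem j.2]

open Polynomial in
theorem mvander_fun (ν : ℕ →₀ ℕ) (f : ℕ → ℝ) :
    ∑ η ∈ Finset.Icc 0 ν, (mchoose ν η : ℝ) * f (deg η) =
      ∑ k ∈ Finset.range (deg ν + 1), ((deg ν).choose k : ℝ) * f k := by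
  let L : ℝ[X] →ₗ[ℝ] ℝ := Polynomial.lsum (fun k => (f k) • LinearMap.id)
  have hL : ∀ (c k : ℕ), L ((c : ℝ[X]) * X ^ k) = c * f k := by
    intro c k
    rw [← Polynomial.C_eq_natCast, Polynomial.C_mul_X_pow_eq_monomial]
    simp [L, Polynomial.lsum_apply, Polynomial.sum_monomial_index, mul_comm]
  have h := congrArg L (mvander ν)
  rw [add_pow, map_sum, map_sum] at h
  simp only [hL, one_pow, mul_one] at h
  rw [h]
  refine Finset.sum_congr rfl fun k _ => ?_
  rw [mul_comm (X ^ k), hL]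

theorem deg_add (a b : ℕ →₀ ℕ) : deg (a + b) = deg a + deg b :=
  Finsupp.sum_add_index' (fun _ => rfl) (fun _ _ _ => rfl)

theorem deg_pos (a : ℕ →₀ ℕ) (h : a ≠ 0) : deg a ≠ 0 := by
  intro h0
  apply h
  ext j
  by_contra hj
  have := (Finset.sum_eq_zero_iff.1 h0) j (Finsupp.mem_support_iff.2 hj)
  exact hj this

theorem stmt2 (ν : ℕ →₀ ℕ) :
    ∑ η ∈ Finset.Ioo 0 ν, (mchoose ν η : ℝ) * gd (deg η) * gd (deg (ν - η))
      ≤ 2 * gd (deg ν) := by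
  have h0 : ∀ k, 0 ≤ (if k = 0 ∨ k = deg ν then 0 else gd k * gd (deg ν - k)) := by
    intro k
    split_ifs
    · exact le_rfl
    · exact mul_nonneg (gd_nonneg _) (gd_nonneg _)
  have h1 : ∑ η ∈ Finset.Ioo 0 ν, (mchoose ν η : ℝ) * gd (deg η) * gd (deg (ν - η)) ≤
      ∑ η ∈ Finset.Icc 0 ν, (mchoose ν η : ℝ) *
        (fun k => if k = 0 ∨ k = deg ν then 0 else gd k * gd (deg ν - k)) (deg η) := by
    refine le_trans (le_of_eq ?_) (Finset.sum_le_sum_of_subset_of_nonneg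
      Finset.Ioo_subset_Icc_self fun η _ _ => mul_nonneg (Nat.cast_nonneg _) (h0 _))
    refine Finset.sum_congr rfl fun η hη => ?_
    rw [Finset.mem_Ioo] at hη
    have hd : deg η + deg (ν - η) = deg ν := by
      rw [← deg_add, add_tsub_cancel_of_le hη.2.le]
    have a1 := deg_pos η hη.1.ne'
    have a2 := deg_pos (ν - η) (fun h => hη.2.not_ge (tsub_eq_zero_iff_le.1 h))
    have hn : ¬ (deg η = 0 ∨ deg η = deg ν) := by omega
    have he : deg ν - deg η = deg (ν - η) := by omega
    simp only [hn, if_false, he]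
    ring
  refine h1.trans ?_
  rw [mvander_fun ν (fun k => if k = 0 ∨ k = deg ν then 0 else gd k * gd (deg ν - k))]
  generalize deg ν = n
  rcases n with _ | _ | m
  · simp [gd_nonneg]
  · simp [Finset.sum_range_succ, gd_nonneg]
  · rw [Finset.sum_range_succ, Finset.sum_range_succ', ← gd_conv]
    simp only [true_or, or_true, if_true, mul_zero, add_zero]
    refine le_of_eq (Finset.sum_congr rfl fun k hk => ?_)
    have hk := Finset.mem_range.1 hk
    have hn : ¬ (k + 1 = 0 ∨ k + 1 = m + 1 + 1) := by omega
    have he : m + 1 + 1 - (k + 1) = m - k + 1 := by omega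
    simp only [hn, if_false, he]
end

section
/- For every multi-index ν, the sum over all multi-indices η with 0 < η ≤ ν of (ν choose η) · [1/2]_{|η|} · [1/2]_{|ν−η|} is at most 3 · [1/2]_{|ν|}. -/
open Finset in
theorem prod_sum_finsupp (s : Finset ℕ) (t : ℕ → Finset ℕ) (f : ℕ → ℕ → Polynomial ℝ) :
    ∏ a ∈ s, ∑ b ∈ t a, f a b = ∑ η ∈ s.finsupp t, ∏ a ∈ s, f a (η a) := by
  classical
  rw [Finset.prod_sum, Finset.finsupp, Finset.sum_map]
  have hc : (fun a b => Classical.propDecidable (a = b) : DecidableEq ℕ) =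
    (fun a b => instDecidableEqNat a b) := Subsingleton.elim _ _
  refine Finset.sum_congr (by congr!) fun p _ => ?_
  rw [← Finset.prod_attach s]
  refine Finset.prod_congr rfl fun x _ => ?_
  simp [Finsupp.indicator_of_mem x.2]

theorem deg_eq_of_le {ν η : ℕ →₀ ℕ} (h : η ≤ ν) : deg η = ∑ j ∈ ν.support, η j := by
  unfold deg
  exact Finsupp.sum_of_support_subset _ (Finsupp.support_mono h) _ (by simp)

theorem mchoose_eq_of_le {ν η : ℕ →₀ ℕ} (h : η ≤ ν) :
    mchoose ν η = ∏ j ∈ ν.support, (ν j).choose (η j) := by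
  unfold mchoose
  rw [Finset.union_eq_left.2 (Finsupp.support_mono h)]

theorem deg_sub {ν η : ℕ →₀ ℕ} (h : η ≤ ν) : deg η + deg (ν - η) = deg ν := by
  rw [deg_eq_of_le h, deg_eq_of_le (tsub_le_self : ν - η ≤ ν), deg_eq_of_le le_rfl,
    ← Finset.sum_add_distrib]
  refine Finset.sum_congr rfl fun j _ => ?_
  have := h j
  simp only [Finsupp.tsub_apply]
  omega

open Polynomial in
theorem poly_vandermonde (ν : ℕ →₀ ℕ) :
    ∑ η ∈ Finset.Icc 0 ν, (C (mchoose ν η : ℝ) * X ^ deg η : ℝ[X]) = (X + 1) ^ deg ν := by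
  have h := prod_sum_finsupp ν.support (fun j => Finset.Icc 0 (ν j))
    (fun j i => C ((ν j).choose i : ℝ) * X ^ i)
  have e : ν.support.finsupp (fun j => Finset.Icc 0 (ν j)) = Finset.Icc 0 ν := by
    ext η
    rw [Finset.mem_finsupp_iff, Finset.mem_Icc]
    constructor
    · rintro ⟨h1, h2⟩
      refine ⟨zero_le, fun j => ?_⟩
      by_cases hj : j ∈ ν.support
      · exact (Finset.mem_Icc.1 (h2 j hj)).2
      · have : η j = 0 := by
          by_contra h0
          exact hj (h1 (Finsupp.mem_support_iff.2 h0))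
        omega
    · rintro ⟨_, h2⟩
      exact ⟨Finsupp.support_mono h2, fun j _ => Finset.mem_Icc.2 ⟨Nat.zero_le _, h2 j⟩⟩
  rw [e] at h
  rw [deg_eq_of_le (le_refl ν), ← Finset.prod_pow_eq_pow_sum]
  have h3 : ∀ j ∈ ν.support, ((X + 1 : ℝ[X]) ^ (ν j)) =
      ∑ i ∈ Finset.Icc 0 (ν j), C ((ν j).choose i : ℝ) * X ^ i := by
    intro j _
    rw [add_pow, Finset.range_eq_Ico]
    refine Finset.sum_congr (by ext; simp) fun i _ => ?_
    simp [mul_comm]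
  rw [Finset.prod_congr rfl h3, h]
  refine Finset.sum_congr rfl fun η hη => ?_
  have hle := (Finset.mem_Icc.1 hη).2
  rw [mchoose_eq_of_le hle, deg_eq_of_le hle, Finset.prod_mul_distrib,
    Finset.prod_pow_eq_pow_sum]
  simp

theorem vandermonde_fiber (ν : ℕ →₀ ℕ) (k : ℕ) :
    ∑ η ∈ Finset.Icc 0 ν with deg η = k, (mchoose ν η : ℝ) = ((deg ν).choose k : ℝ) := by
  have h := congrArg (fun p => Polynomial.coeff p k) (poly_vandermonde ν)
  simp only [Polynomial.finsetSum_coeff, Polynomial.coeff_C_mul, Polynomial.coeff_X_pow,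
    Polynomial.coeff_X_add_one_pow] at h
  rw [← h, Finset.sum_filter]
  refine Finset.sum_congr rfl fun η _ => ?_
  by_cases hk : deg η = k
  · simp [hk]
  · simp [hk, Ne.symm hk]

theorem sum_multi (ν : ℕ →₀ ℕ) :
    ∑ η ∈ Finset.Icc 0 ν, (mchoose ν η : ℝ) * gd (deg η) * gd (deg (ν - η)) =
      ∑ ij ∈ Finset.HasAntidiagonal.antidiagonal (deg ν), ((deg ν).choose ij.1 : ℝ) * (gd ij.1 * gd ij.2) := by
  rw [Finset.Nat.sum_antidiagonal_eq_sum_range_succ_mk]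
  rw [← Finset.sum_fiberwise_of_maps_to (s := Finset.Icc 0 ν)
    (t := Finset.range (deg ν).succ) (g := deg)]
  · refine Finset.sum_congr rfl fun k _ => ?_
    rw [← vandermonde_fiber, Finset.sum_mul]
    refine Finset.sum_congr rfl fun η hη => ?_
    obtain ⟨h1, h2⟩ := Finset.mem_filter.1 hη
    have h3 := deg_sub (Finset.mem_Icc.1 h1).2
    have h4 : deg (ν - η) = deg ν - k := by omega
    rw [h4, h2]
    ring
  · intro η hη
    have h3 := deg_sub (Finset.mem_Icc.1 hη).2
    rw [Finset.mem_range]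
    omega

theorem gd_succ (n : ℕ) : gd (n + 1) = ((n : ℝ) - 1 / 2) * gd n + if n = 0 then 1 else 0 := by
  rw [gd]
  rcases Nat.eq_zero_or_pos n with h | h
  · subst h
    norm_num [gd, abs_of_neg]
  · have : (1 : ℝ) ≤ n := by exact_mod_cast h
    rw [abs_of_nonneg (by linarith), if_neg (by omega)]
    ring

noncomputable def convT (n : ℕ) : ℝ :=
  ∑ ij ∈ Finset.HasAntidiagonal.antidiagonal n, (n.choose ij.1 : ℝ) * (gd ij.1 * gd ij.2)

theorem convT_succ (n : ℕ) : convT (n + 1) = ((n : ℝ) - 1) * convT n + 2 * gd n := by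
  unfold convT
  rw [Finset.sum_antidiagonal_choose_succ_mul (fun i j => gd i * gd j), ← Finset.sum_add_distrib]
  have h : ∀ ij ∈ Finset.HasAntidiagonal.antidiagonal n,
      (n.choose ij.1 : ℝ) * (gd ij.1 * gd (ij.2 + 1)) +
        (n.choose ij.2 : ℝ) * (gd (ij.1 + 1) * gd ij.2) =
      ((n : ℝ) - 1) * ((n.choose ij.1 : ℝ) * (gd ij.1 * gd ij.2)) +
        ((if ij = (n, 0) then gd n else 0) + (if ij = (0, n) then gd n else 0)) := by
    rintro ⟨i, j⟩ hij
    rw [Finset.HasAntidiagonal.mem_antidiagonal] at hij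
    simp only at hij ⊢
    rw [gd_succ, gd_succ, Nat.choose_symm_of_eq_add hij.symm]
    have hn : (n : ℝ) = i + j := by exact_mod_cast hij.symm
    have e1 : ((i, j) = (n, 0)) ↔ j = 0 := by simp only [Prod.mk.injEq]; omega
    have e2 : ((i, j) = (0, n)) ↔ i = 0 := by simp only [Prod.mk.injEq]; omega
    simp only [e1, e2, hn]
    have f1 : (if j = 0 then gd n else 0) = (n.choose j : ℝ) * gd i * (if j = 0 then 1 else 0) := by
      split_ifs with h
      · subst h
        simp [← hij]
      · simp
    have f2 : (if i = 0 then gd n else 0) = (n.choose j : ℝ) * gd j * (if i = 0 then 1 else 0) := by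
      split_ifs with h
      · subst h
        simp [← hij]
      · simp
    rw [f1, f2]
    ring
  rw [Finset.sum_congr rfl h, Finset.sum_add_distrib, Finset.sum_add_distrib, ← Finset.mul_sum]
  simp
  ring

theorem convT_eq (n : ℕ) : convT (n + 2) = 4 * gd (n + 2) := by
  have h0 : gd 0 = 1 := rfl
  have h1 : gd 1 = 1 / 2 := by rw [gd_succ, h0]; norm_num
  induction n with
  | zero =>
    have h2 : gd 2 = 1 / 4 := by rw [gd_succ, h1]; norm_num
    rw [convT_succ]
    norm_num [h1, h2]
  | succ n ih =>
    rw [show n + 1 + 2 = (n + 2) + 1 from rfl, convT_succ, ih, gd_succ (n + 2)]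
    push_cast
    simp
    ring

theorem convT_sub_le (n : ℕ) : convT n - gd n ≤ 3 * gd n := by
  have h0 : gd 0 = 1 := rfl
  have h1 : gd 1 = 1 / 2 := by rw [gd_succ, h0]; norm_num
  have t0 : convT 0 = 1 := by simp [convT, h0]
  match n with
  | 0 => rw [t0, h0]; norm_num
  | 1 => rw [convT_succ 0, t0, h0, h1]; norm_num
  | n + 2 => rw [convT_eq]; linarith

theorem stmt4 (ν : ℕ →₀ ℕ) :
    ∑ η ∈ Finset.Ioc 0 ν, (mchoose ν η : ℝ) * gd (deg η) * gd (deg (ν - η))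
      ≤ 3 * gd (deg ν) := by
  have h := sum_multi ν
  rw [← Finset.Ioc_insert_left (zero_le : 0 ≤ ν), Finset.sum_insert (by simp)] at h
  have h2 := convT_sub_le (deg ν)
  have h3 : mchoose ν 0 = 1 := by simp [mchoose]
  have h4 : gd (deg 0) = 1 := rfl
  rw [h3, h4, tsub_zero] at h
  unfold convT at h2
  push_cast at h
  linarith
end

section
/- Let s, d ≥ 1 be natural numbers, let δ ≥ 1 be real, let b ∈ (0,∞)^s, and let M : ℝ^s → ℝ^{d×d} be a C^∞ matrix-valued function. Suppose there is a constant C_M ≥ 1 such that for every multi-index ν ∈ ℕ^s and every y ∈ ℝ^s, ‖∂^ν M(y)‖_F ≤ C_M · b^ν · [1/2]_{|ν|} · (|ν|!)^{δ−1}. Then for every multi-index ν ∈ ℕ^s and every y ∈ ℝ^s, |∂^ν (det M)(y)| ≤ d! · (4C_M)^d · b^ν · [1/2]_{|ν|} · (|ν|!)^{δ−1}, where det M denotes the pointwise determinant y ↦ det(M(y)). -/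
/-- Partial derivative along the `j`-th coordinate direction:
`∂_j f (y)` is the derivative at `t = 0` of `t ↦ f (y + t e_j)`. -/
noncomputable def pd {s : ℕ} (j : Fin s) (f : (Fin s → ℝ) → ℝ) : (Fin s → ℝ) → ℝ :=
  fun y => deriv (fun t : ℝ => f (y + t • (Pi.single j 1 : Fin s → ℝ))) 0

/-- Iterated partial derivative `∂^ν f = ∂₁^{ν₁} ⋯ ∂_s^{ν_s} f`. -/
noncomputable def pdMulti {s : ℕ} (ν : Fin s → ℕ) (f : (Fin s → ℝ) → ℝ) :
    (Fin s → ℝ) → ℝ :=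
  (List.finRange s).foldr (fun j g => (pd j)^[ν j] g) f

/-- The Frobenius norm `‖A‖_F = (Σ_{i,j} A_{ij}²)^{1/2}` of a real matrix. -/
noncomputable def frob {d : ℕ} (A : Matrix (Fin d) (Fin d) ℝ) : ℝ :=
  Real.sqrt (∑ i, ∑ j, (A i j) ^ 2)

/-- Entrywise iterated partial derivative `∂^ν M` of a matrix-valued function. -/
noncomputable def pdMat {s d : ℕ} (ν : Fin s → ℕ)
    (M : (Fin s → ℝ) → Matrix (Fin d) (Fin d) ℝ) :
    (Fin s → ℝ) → Matrix (Fin d) (Fin d) ℝ :=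
  fun y => Matrix.of fun i j => pdMulti ν (fun z => M z i j) y

lemma gd_nonneg_s11 : ∀ n, 0 ≤ gd n
  | 0 => by simp [gd]
  | n + 1 => by rw [gd]; exact mul_nonneg (abs_nonneg _) (gd_nonneg_s11 n)

open PowerSeries in
/-- The power series of `√(1 - x)`, whose coefficients are `- gd n / n!` for `n ≥ 1`. -/
noncomputable def sqS : PowerSeries ℝ :=
  PowerSeries.mk fun n => if n = 0 then 1 else - (gd n / n.factorial)

lemma sqS_rec (n : ℕ) : PowerSeries.coeff (n+1) sqS * (n + 1) = (n - 1/2) * PowerSeries.coeff n sqS := by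
  simp only [sqS, PowerSeries.coeff_mk]
  rcases n with _ | n
  · norm_num [gd]
  · have h : |((n + 1 : ℕ) : ℝ) - 1/2| = n + 1 - 1/2 := by
      push_cast
      rw [abs_of_nonneg]
      have : (0:ℝ) ≤ n := n.cast_nonneg
      linarith
    have h2 : ((n+1).factorial : ℝ) ≠ 0 := by positivity
    simp only [Nat.add_eq_zero_iff, one_ne_zero, and_false, if_false]
    rw [gd, h, Nat.factorial_succ (n+1)]
    push_cast
    have : (n:ℝ) + 1 + 1 ≠ 0 := by positivity
    field_simp

lemma sqS_ode : (1 - PowerSeries.X) * (2 * PowerSeries.derivative ℝ sqS) = - sqS := by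
  rw [sub_mul, one_mul, ← map_ofNat (PowerSeries.C (R := ℝ)) 2]
  ext n
  rcases n with _ | n
  · have := sqS_rec 0
    have h2 := PowerSeries.coeff_derivative sqS 0
    simp at this h2 ⊢
    rw [h2, this]
    change (2:ℝ) * _ = _
    ring
  · have := sqS_rec (n+1)
    simp [PowerSeries.coeff_succ_X_mul, PowerSeries.coeff_derivative] at this ⊢
    linarith

lemma sqS_sq : sqS * sqS = 1 - PowerSeries.X := by
  have hode : (1 - PowerSeries.X) * PowerSeries.derivative ℝ (sqS * sqS) = - (sqS * sqS) := by
    have h := sqS_ode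
    rw [Derivation.leibniz]
    simp only [smul_eq_mul]
    linear_combination sqS * h
  have h0 : PowerSeries.coeff 0 (sqS * sqS) = 1 := by
    simp [sqS]
  generalize sqS * sqS = U at *
  rw [sub_mul, one_mul] at hode
  have h1 : PowerSeries.coeff 1 U = -1 := by
    have := congrArg (PowerSeries.coeff 0) hode
    have h2 := PowerSeries.coeff_derivative U 0
    simp at this h0 h2
    linarith
  have h2 : ∀ n, PowerSeries.coeff (n+2) U = 0 := by
    have hr : ∀ n : ℕ, PowerSeries.coeff (n+2) U * (n + 2) = n * PowerSeries.coeff (n+1) U := by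
      intro n
      have := congrArg (PowerSeries.coeff (n+1)) hode
      simp [PowerSeries.coeff_succ_X_mul, PowerSeries.coeff_derivative] at this
      linarith
    intro n
    induction n with
    | zero => simpa using hr 0
    | succ n ih =>
      have := hr (n+1)
      rw [ih, mul_zero] at this
      have h3 : ((n+1 : ℕ) : ℝ) + 2 ≠ 0 := by positivity
      exact (mul_eq_zero.1 this).resolve_right h3
  ext n
  match n with
  | 0 => simpa using h0
  | 1 => rw [h1]; simp [PowerSeries.coeff_one]
  | n + 2 => rw [h2]; simp [PowerSeries.coeff_one, PowerSeries.coeff_X]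

lemma gd_conv_s11 (n : ℕ) :
    ∑ p ∈ Finset.HasAntidiagonal.antidiagonal n, (n.choose p.1 : ℝ) * (gd p.1 * gd p.2) ≤ 4 * gd n := by
  let G : PowerSeries ℝ := PowerSeries.mk fun n => gd n / n.factorial
  have hG : G = PowerSeries.C 2 - sqS := by
    ext n
    rcases n with _ | n
    · simp [G, sqS, gd]; norm_num
    · simp [G, sqS, PowerSeries.coeff_C]
  have hGG : G * G = PowerSeries.C 4 * G - PowerSeries.C 3 - PowerSeries.X := by
    have h := sqS_sq
    have e3 : (PowerSeries.C 3 : PowerSeries ℝ) = 3 := map_ofNat _ 3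
    have e2 : (PowerSeries.C 2 : PowerSeries ℝ) = 2 := map_ofNat _ 2
    have e4 : (PowerSeries.C 4 : PowerSeries ℝ) = 4 := map_ofNat _ 4
    rw [hG, e3, e2, e4]
    linear_combination h
  have hn : (0:ℝ) < n.factorial := by positivity
  have hle : PowerSeries.coeff n (G * G) ≤ 4 * (gd n / n.factorial) := by
    rw [hGG]
    simp only [map_sub, PowerSeries.coeff_C_mul, PowerSeries.coeff_C, PowerSeries.coeff_X]
    have : PowerSeries.coeff n G = gd n / n.factorial := by simp [G]
    rw [this]
    split_ifs <;> linarith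
  have heq : ∑ p ∈ Finset.HasAntidiagonal.antidiagonal n, (n.choose p.1 : ℝ) * (gd p.1 * gd p.2)
      = n.factorial * PowerSeries.coeff n (G * G) := by
    rw [PowerSeries.coeff_mul, Finset.mul_sum]
    refine Finset.sum_congr rfl fun p hp => ?_
    rw [Finset.HasAntidiagonal.mem_antidiagonal] at hp
    subst hp
    simp only [G, PowerSeries.coeff_mk]
    rw [Nat.choose_symm_add, Nat.add_choose, Nat.cast_div (Nat.factorial_mul_factorial_dvd_factorial_add _ _) (by positivity)]
    have h1 : (p.1.factorial : ℝ) ≠ 0 := by positivity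
    have h2 : (p.2.factorial : ℝ) ≠ 0 := by positivity
    push_cast
    field_simp
  rw [heq]
  calc _ ≤ n.factorial * (4 * (gd n / n.factorial)) := by gcongr
    _ = _ := by field_simp

/-- The weight `[1/2]_n (n!)^{δ-1}`. -/
noncomputable def wt (δ : ℝ) (n : ℕ) : ℝ := gd n * (n.factorial : ℝ) ^ (δ - 1)

lemma wt_nonneg (δ : ℝ) (n : ℕ) : 0 ≤ wt δ n :=
  mul_nonneg (gd_nonneg_s11 n) (by positivity)

lemma wt_conv {δ : ℝ} (hδ : 1 ≤ δ) (n : ℕ) :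
    ∑ p ∈ Finset.HasAntidiagonal.antidiagonal n, (n.choose p.1 : ℝ) * (wt δ p.1 * wt δ p.2) ≤ 4 * wt δ n := by
  calc _ ≤ ∑ p ∈ Finset.HasAntidiagonal.antidiagonal n,
        ((n.choose p.1 : ℝ) * (gd p.1 * gd p.2)) * (n.factorial : ℝ) ^ (δ - 1) := by
        refine Finset.sum_le_sum fun p hp => ?_
        rw [Finset.HasAntidiagonal.mem_antidiagonal] at hp
        have h : (p.1.factorial : ℝ) ^ (δ - 1) * (p.2.factorial : ℝ) ^ (δ - 1)
            ≤ (n.factorial : ℝ) ^ (δ - 1) := by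
          rw [← Real.mul_rpow (by positivity) (by positivity)]
          apply Real.rpow_le_rpow (by positivity) _ (by linarith)
          rw [← hp]
          exact_mod_cast Nat.le_of_dvd (Nat.factorial_pos _)
            (Nat.factorial_mul_factorial_dvd_factorial_add _ _)
        have h0 : 0 ≤ (n.choose p.1 : ℝ) * (gd p.1 * gd p.2) :=
          mul_nonneg (by positivity) (mul_nonneg (gd_nonneg_s11 _) (gd_nonneg_s11 _))
        calc _ = ((n.choose p.1 : ℝ) * (gd p.1 * gd p.2)) *
              ((p.1.factorial : ℝ) ^ (δ - 1) * (p.2.factorial : ℝ) ^ (δ - 1)) := by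
              unfold wt; ring
          _ ≤ _ := mul_le_mul_of_nonneg_left h h0
    _ ≤ (4 * gd n) * (n.factorial : ℝ) ^ (δ - 1) := by
        rw [← Finset.sum_mul]
        exact mul_le_mul_of_nonneg_right (gd_conv_s11 n) (by positivity)
    _ = _ := by unfold wt; ring

section deriv
variable {s : ℕ}

lemma pd_hasDeriv {f : (Fin s → ℝ) → ℝ} (hf : ContDiff ℝ (⊤ : ℕ∞) f) (j : Fin s) (y : Fin s → ℝ) :
    HasDerivAt (fun t : ℝ => f (y + t • (Pi.single j 1 : Fin s → ℝ)))
      (fderiv ℝ f y (Pi.single j 1)) 0 := by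
  have h1 : HasFDerivAt f (fderiv ℝ f y) (y + (0:ℝ) • (Pi.single j 1 : Fin s → ℝ)) := by
    rw [zero_smul, add_zero]
    exact (hf.differentiable (by simp) y).hasFDerivAt
  have h2 : HasDerivAt (fun t : ℝ => y + t • (Pi.single j 1 : Fin s → ℝ))
      (Pi.single j 1 : Fin s → ℝ) 0 := by
    simpa using ((hasDerivAt_id (0:ℝ)).smul_const (Pi.single j 1 : Fin s → ℝ)).const_add y
  exact h1.comp_hasDerivAt 0 h2

lemma pd_eq {f : (Fin s → ℝ) → ℝ} (hf : ContDiff ℝ (⊤ : ℕ∞) f) (j : Fin s) :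
    pd j f = fun y => fderiv ℝ f y (Pi.single j 1) :=
  funext fun y => (pd_hasDeriv hf j y).deriv

lemma pd_smooth {f : (Fin s → ℝ) → ℝ} (hf : ContDiff ℝ (⊤ : ℕ∞) f) (j : Fin s) :
    ContDiff ℝ (⊤ : ℕ∞) (pd j f) := by
  rw [pd_eq hf]
  exact (hf.fderiv_right (by simp)).clm_apply contDiff_const

lemma pd_lin {f g : (Fin s → ℝ) → ℝ} (hf : ContDiff ℝ (⊤ : ℕ∞) f) (hg : ContDiff ℝ (⊤ : ℕ∞) g)
    (c : ℝ) (j : Fin s) :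
    pd j (fun y => c * f y + g y) = fun y => c * pd j f y + pd j g y := by
  funext y
  have h := ((pd_hasDeriv hf j y).const_mul c).add (pd_hasDeriv hg j y)
  rw [pd_eq hf, pd_eq hg]
  exact h.deriv

lemma pd_mul {f g : (Fin s → ℝ) → ℝ} (hf : ContDiff ℝ (⊤ : ℕ∞) f) (hg : ContDiff ℝ (⊤ : ℕ∞) g)
    (j : Fin s) :
    pd j (fun y => f y * g y) = fun y => 1 * (pd j f y * g y) + f y * pd j g y := by
  funext y
  have h := (pd_hasDeriv hf j y).mul (pd_hasDeriv hg j y)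
  rw [pd_eq hf, pd_eq hg]
  refine h.deriv.trans ?_
  simp

lemma pd_iter_lin {f g : (Fin s → ℝ) → ℝ} (hf : ContDiff ℝ (⊤ : ℕ∞) f)
    (hg : ContDiff ℝ (⊤ : ℕ∞) g) (c : ℝ) (j : Fin s) (n : ℕ) :
    (pd j)^[n] (fun y => c * f y + g y) = (fun y => c * (pd j)^[n] f y + (pd j)^[n] g y) := by
  induction n generalizing f g with
  | zero => rfl
  | succ n ih =>
    simp only [Function.iterate_succ_apply]
    rw [pd_lin hf hg, ih (pd_smooth hf j) (pd_smooth hg j)]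

lemma pd_iter_smooth {f : (Fin s → ℝ) → ℝ} (hf : ContDiff ℝ (⊤ : ℕ∞) f) (j : Fin s) (n : ℕ) :
    ContDiff ℝ (⊤ : ℕ∞) ((pd j)^[n] f) := by
  induction n generalizing f with
  | zero => exact hf
  | succ n ih =>
    simp only [Function.iterate_succ_apply]
    exact ih (pd_smooth hf j)

lemma fold_smooth {f : (Fin s → ℝ) → ℝ} (hf : ContDiff ℝ (⊤ : ℕ∞) f) (ν : Fin s → ℕ)
    (l : List (Fin s)) :
    ContDiff ℝ (⊤ : ℕ∞) (l.foldr (fun j g => (pd j)^[ν j] g) f) := by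
  induction l with
  | nil => exact hf
  | cons i l ih => exact pd_iter_smooth ih i _

lemma pdMulti_lin {f g : (Fin s → ℝ) → ℝ} (hf : ContDiff ℝ (⊤ : ℕ∞) f)
    (hg : ContDiff ℝ (⊤ : ℕ∞) g) (c : ℝ) (ν : Fin s → ℕ) :
    pdMulti ν (fun y => c * f y + g y) = fun y => c * pdMulti ν f y + pdMulti ν g y := by
  unfold pdMulti
  induction List.finRange s with
  | nil => rfl
  | cons i l ih =>
    simp only [List.foldr_cons]
    rw [ih, pd_iter_lin (fold_smooth hf ν l) (fold_smooth hg ν l)]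

lemma fold_zero (f : (Fin s → ℝ) → ℝ) (ν : Fin s → ℕ) (l : List (Fin s))
    (h : ∀ i ∈ l, ν i = 0) : l.foldr (fun j g => (pd j)^[ν j] g) f = f := by
  induction l with
  | nil => rfl
  | cons i l ih =>
    rw [List.foldr_cons, ih fun k hk => h k (List.mem_cons_of_mem _ hk),
      h i List.mem_cons_self]
    rfl

lemma fold_succ (f : (Fin s → ℝ) → ℝ) (μ : Fin s → ℕ) (j : Fin s) (h : ∀ i, j < i → μ i = 0)
    (l : List (Fin s)) (hl : l.Pairwise (· < ·)) (hj : j ∈ l) :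
    l.foldr (fun i g => (pd i)^[(μ + Pi.single j 1 : Fin s → ℕ) i] g) f
      = l.foldr (fun i g => (pd i)^[μ i] g) (pd j f) := by
  induction l with
  | nil => simp at hj
  | cons i l ih =>
    rw [List.pairwise_cons] at hl
    rw [List.foldr_cons, List.foldr_cons]
    by_cases hij : i = j
    · subst hij
      rw [fold_zero _ μ l fun k hk => h k (hl.1 k hk), fold_zero _ (μ + Pi.single i 1) l]
      · simp [Function.iterate_succ_apply]
      · intro k hk
        have := hl.1 k hk
        simp [h k this, this.ne']
    · have hj' : j ∈ l := by
        rcases List.mem_cons.1 hj with h | h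
        · exact absurd h.symm hij
        · exact h
      rw [ih hl.2 hj']
      simp [hij]

lemma pdMulti_succ (f : (Fin s → ℝ) → ℝ) (μ : Fin s → ℕ) (j : Fin s)
    (h : ∀ i, j < i → μ i = 0) :
    pdMulti (μ + Pi.single j 1) f = pdMulti μ (pd j f) :=
  fold_succ f μ j h _ (List.pairwise_lt_finRange s) (List.mem_finRange j)

lemma exists_succ (ν : Fin s → ℕ) (h : ν ≠ 0) :
    ∃ (j : Fin s) (μ : Fin s → ℕ), ν = μ + Pi.single j 1 ∧ ∀ i, j < i → μ i = 0 := by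
  classical
  have hne : (Finset.univ.filter fun i => ν i ≠ 0).Nonempty := by
    obtain ⟨i, hi⟩ := Function.ne_iff.1 h
    exact ⟨i, by simpa using hi⟩
  let j := (Finset.univ.filter fun i => ν i ≠ 0).max' hne
  have hj : ν j ≠ 0 := by
    have := Finset.max'_mem _ hne
    exact (Finset.mem_filter.1 this).2
  refine ⟨j, ν - Pi.single j 1, ?_, ?_⟩
  · funext i
    by_cases hij : i = j
    · subst hij
      simp
      omega
    · simp [hij]
  · intro i hi
    have : ν i = 0 := by
      by_contra hc
      have := Finset.le_max' (Finset.univ.filter fun i => ν i ≠ 0) i (by simpa using hc)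
      exact absurd hi (not_lt.2 this)
    simp [this]

lemma sum_add_single (μ : Fin s → ℕ) (j : Fin s) :
    ∑ i, (μ + Pi.single j 1 : Fin s → ℕ) i = ∑ i, μ i + 1 := by
  simp [Finset.sum_add_distrib]

lemma prod_add_single (b : Fin s → ℝ) (μ : Fin s → ℕ) (j : Fin s) :
    ∏ i, b i ^ (μ + Pi.single j 1 : Fin s → ℕ) i = (∏ i, b i ^ μ i) * b j := by
  simp only [Pi.add_apply, pow_add, Finset.prod_mul_distrib]
  congr 1
  rw [Finset.prod_eq_single j] <;> simp +contextual

lemma leibniz_bound (b : Fin s → ℝ) (hb : ∀ j, 0 < b j) (n : ℕ) :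
    ∀ (ν : Fin s → ℕ), ∑ i, ν i = n → ∀ (f g : (Fin s → ℝ) → ℝ) (α β : ℕ → ℝ),
      ContDiff ℝ (⊤ : ℕ∞) f → ContDiff ℝ (⊤ : ℕ∞) g →
      (∀ μ ≤ ν, ∀ y, |pdMulti μ f y| ≤ (∏ i, b i ^ μ i) * α (∑ i, μ i)) →
      (∀ μ ≤ ν, ∀ y, |pdMulti μ g y| ≤ (∏ i, b i ^ μ i) * β (∑ i, μ i)) →
      ∀ y, |pdMulti ν (fun z => f z * g z) y| ≤ (∏ i, b i ^ ν i) *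
        ∑ p ∈ Finset.HasAntidiagonal.antidiagonal n, (n.choose p.1 : ℝ) * (α p.1 * β p.2) := by
  have key0 : ∀ f : (Fin s → ℝ) → ℝ, pdMulti 0 f = f := fun f => fold_zero f 0 _ (by simp)
  induction n with
  | zero =>
    intro ν hν f g α β hf hg hα hβ y
    have : ν = 0 := by
      funext i
      simpa using (Finset.sum_eq_zero_iff.1 hν) i (Finset.mem_univ i)
    subst this
    have h1 := hα 0 le_rfl y
    have h2 := hβ 0 le_rfl y
    rw [key0] at h1 h2 ⊢
    simp at h1 h2 ⊢
    exact mul_le_mul h1 h2 (abs_nonneg _) ((abs_nonneg _).trans h1)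
  | succ n ih =>
    intro ν hν f g α β hf hg hα hβ y
    obtain ⟨j, μ, rfl, hμ⟩ := exists_succ ν (by rintro rfl; simp at hν)
    have hn : ∑ i, μ i = n := by
      rw [sum_add_single] at hν; omega
    have hle : ∀ κ ≤ μ, κ ≤ μ + Pi.single j 1 := fun κ hκ => hκ.trans (by simp)
    have shift : ∀ (h : (Fin s → ℝ) → ℝ) (γ : ℕ → ℝ),
        (∀ κ ≤ μ + Pi.single j 1, ∀ y, |pdMulti κ h y| ≤ (∏ i, b i ^ κ i) * γ (∑ i, κ i)) →
        ∀ κ ≤ μ, ∀ y, |pdMulti κ (pd j h) y|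
          ≤ (∏ i, b i ^ κ i) * (fun k => b j * γ (k+1)) (∑ i, κ i) := by
      intro h γ hh κ hκ y
      have h0 : ∀ i, j < i → κ i = 0 := fun i hi => by
        have : κ i ≤ μ i := hκ i
        rw [hμ i hi] at this
        omega
      have := hh (κ + Pi.single j 1) (by gcongr) y
      rw [pdMulti_succ h κ j h0, sum_add_single, prod_add_single, mul_assoc] at this
      exact this
    have e1 := ih μ hn (pd j f) g (fun k => b j * α (k+1)) β (pd_smooth hf j) hg
      (shift f α hα) (fun κ hκ => hβ κ (hle κ hκ)) y
    have e2 := ih μ hn f (pd j g) α (fun k => b j * β (k+1)) hf (pd_smooth hg j)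
      (fun κ hκ => hα κ (hle κ hκ)) (shift g β hβ) y
    rw [pdMulti_succ _ μ j hμ, pd_mul hf hg,
      pdMulti_lin ((pd_smooth hf j).mul hg) (hf.mul (pd_smooth hg j)), prod_add_single]
    have e3 := abs_add_le (1 * pdMulti μ (fun y => pd j f y * g y) y)
      (pdMulti μ (fun y => f y * pd j g y) y)
    rw [one_mul] at e3
    simp only [one_mul]
    refine (e3.trans (add_le_add e1 e2)).trans (le_of_eq ?_)
    have := Finset.sum_antidiagonal_choose_succ_mul (R := ℝ) (fun i k => α i * β k) n
    rw [this, mul_assoc, ← mul_add, ← Finset.sum_add_distrib, ← Finset.sum_add_distrib,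
      Finset.mul_sum (a := b j)]
    congr 1
    refine Finset.sum_congr rfl fun p hp => ?_
    have hc : n.choose p.2 = n.choose p.1 := by
      rw [Finset.HasAntidiagonal.mem_antidiagonal] at hp
      subst hp
      rw [Nat.choose_symm_add]
    rw [hc]
    ring

/-- `f` is smooth with derivative bounds of constant `C`. -/
def Bd (b : Fin s → ℝ) (δ C : ℝ) (f : (Fin s → ℝ) → ℝ) : Prop :=
  ContDiff ℝ (⊤ : ℕ∞) f ∧
    ∀ ν y, |pdMulti ν f y| ≤ (∏ i, b i ^ ν i) * (C * wt δ (∑ i, ν i))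

lemma Bd.mul {b : Fin s → ℝ} (hb : ∀ j, 0 < b j) {δ : ℝ} (hδ : 1 ≤ δ) {C D : ℝ} (hC : 0 ≤ C)
    (hD : 0 ≤ D) {f g : (Fin s → ℝ) → ℝ} (hf : Bd b δ C f) (hg : Bd b δ D g) :
    Bd b δ (4 * C * D) (fun z => f z * g z) := by
  refine ⟨hf.1.mul hg.1, fun ν y => ?_⟩
  refine (leibniz_bound b hb _ ν rfl f g (fun n => C * wt δ n) (fun n => D * wt δ n) hf.1 hg.1
    (fun μ _ => hf.2 μ) (fun μ _ => hg.2 μ) y).trans ?_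
  have hp : 0 ≤ ∏ i, b i ^ ν i := Finset.prod_nonneg fun i _ => (pow_pos (hb i) _).le
  refine mul_le_mul_of_nonneg_left ?_ hp
  have := mul_le_mul_of_nonneg_left (wt_conv hδ (∑ i, ν i)) (mul_nonneg hC hD)
  refine le_trans (le_of_eq ?_) (this.trans (le_of_eq (by ring)))
  rw [Finset.mul_sum]
  exact Finset.sum_congr rfl fun p _ => by ring

lemma pdMulti_zero_fun (ν : Fin s → ℕ) (y : Fin s → ℝ) :
    pdMulti ν (fun _ => (0:ℝ)) y = 0 := by
  have := congrFun (pdMulti_lin (s := s) (f := fun _ => (0:ℝ)) (g := fun _ => (0:ℝ))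
    contDiff_const contDiff_const 1 ν) y
  simp at this
  exact this

lemma Bd.lin {b : Fin s → ℝ} {δ : ℝ} {C D : ℝ} (c : ℝ) (hc : |c| = 1)
    {f g : (Fin s → ℝ) → ℝ} (hf : Bd b δ C f) (hg : Bd b δ D g) :
    Bd b δ (C + D) (fun z => c * f z + g z) := by
  refine ⟨(contDiff_const.mul hf.1).add hg.1, fun ν y => ?_⟩
  rw [pdMulti_lin hf.1 hg.1]
  refine (abs_add_le _ _).trans ?_
  rw [abs_mul, hc, one_mul]
  have h1 := hf.2 ν y
  have h2 := hg.2 ν y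
  linarith

lemma Bd.zero {b : Fin s → ℝ} {δ : ℝ} : Bd b δ 0 (fun _ => (0:ℝ)) :=
  ⟨contDiff_const, fun ν y => by rw [pdMulti_zero_fun]; simp⟩

lemma Bd.one {b : Fin s → ℝ} (hb : ∀ j, 0 < b j) {δ : ℝ} : Bd b δ 1 (fun _ => (1:ℝ)) := by
  refine ⟨contDiff_const, fun ν y => ?_⟩
  by_cases h : ν = 0
  · subst h
    have : pdMulti 0 (fun _ : Fin s → ℝ => (1:ℝ)) = fun _ => 1 := fold_zero _ 0 _ (by simp)
    rw [this]
    simp [wt, gd]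
  · obtain ⟨j, μ, rfl, hμ⟩ := exists_succ ν h
    have h0 : pd j (fun _ : Fin s → ℝ => (1:ℝ)) = fun _ => 0 := by
      funext y; simp [pd]
    rw [pdMulti_succ _ μ j hμ, h0, pdMulti_zero_fun, abs_zero]
    exact mul_nonneg (Finset.prod_nonneg fun i _ => (pow_pos (hb i) _).le)
      (mul_nonneg zero_le_one (wt_nonneg _ _))

lemma Bd.prod {b : Fin s → ℝ} (hb : ∀ j, 0 < b j) {δ : ℝ} (hδ : 1 ≤ δ) {C : ℝ} (hC : 0 ≤ C)
    {ι : Type*} (S : Finset ι) (f : ι → (Fin s → ℝ) → ℝ) (hf : ∀ i, Bd b δ C (f i)) :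
    Bd b δ ((4 * C) ^ S.card) (fun z => ∏ i ∈ S, f i z) := by
  classical
  induction S using Finset.induction_on with
  | empty => simpa using Bd.one hb
  | insert a S ha ih =>
    have := Bd.mul hb hδ hC (by positivity) (hf a) ih
    simp only [Finset.prod_insert ha, Finset.card_insert_of_notMem ha, pow_succ']
    exact this

lemma Bd.sum {b : Fin s → ℝ} {δ : ℝ} {C : ℝ}
    {ι : Type*} (S : Finset ι) (c : ι → ℝ) (hc : ∀ i, |c i| = 1)
    (f : ι → (Fin s → ℝ) → ℝ) (hf : ∀ i, Bd b δ C (f i)) :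
    Bd b δ (S.card * C) (fun z => ∑ i ∈ S, c i * f i z) := by
  classical
  induction S using Finset.induction_on with
  | empty => simpa using Bd.zero
  | insert a S ha ih =>
    have := Bd.lin (c a) (hc a) (hf a) ih
    simp only [Finset.sum_insert ha, Finset.card_insert_of_notMem ha]
    convert this using 1
    push_cast
    ring

end deriv

lemma entry_le_frob {d : ℕ} (A : Matrix (Fin d) (Fin d) ℝ) (i j : Fin d) : |A i j| ≤ frob A := by
  unfold frob
  apply Real.abs_le_sqrt
  calc (A i j) ^ 2 ≤ ∑ j, (A i j) ^ 2 :=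
        Finset.single_le_sum (f := fun j => (A i j) ^ 2) (fun _ _ => sq_nonneg _) (Finset.mem_univ j)
    _ ≤ _ := Finset.single_le_sum (f := fun i => ∑ j, (A i j) ^ 2)
        (fun _ _ => Finset.sum_nonneg fun _ _ => sq_nonneg _) (Finset.mem_univ i)

theorem stmt11 {s d : ℕ} (hs : 1 ≤ s) (hd : 1 ≤ d) (δ : ℝ) (hδ : 1 ≤ δ)
    (b : Fin s → ℝ) (hb : ∀ j, 0 < b j)
    (M : (Fin s → ℝ) → Matrix (Fin d) (Fin d) ℝ)
    (hM : ∀ i j, ContDiff ℝ (⊤ : ℕ∞) fun y => M y i j)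
    (CM : ℝ) (hCM : 1 ≤ CM)
    (hMb : ∀ (ν : Fin s → ℕ) (y : Fin s → ℝ),
      frob (pdMat ν M y)
        ≤ CM * (∏ j, b j ^ ν j) * gd (∑ j, ν j) * ((∑ j, ν j).factorial : ℝ) ^ (δ - 1)) :
    ∀ (ν : Fin s → ℕ) (y : Fin s → ℝ),
      |pdMulti ν (fun z => (M z).det) y|
        ≤ (d.factorial : ℝ) * (4 * CM) ^ d * (∏ j, b j ^ ν j) * gd (∑ j, ν j) *
            ((∑ j, ν j).factorial : ℝ) ^ (δ - 1) := by
  intro ν y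
  have hE : ∀ i j, Bd b δ CM (fun z => M z i j) := fun i j => by
    refine ⟨hM i j, fun ν y => ?_⟩
    have h := (entry_le_frob (pdMat ν M y) i j).trans (hMb ν y)
    refine le_trans h (le_of_eq ?_)
    unfold wt
    ring
  have hP := fun σ : Equiv.Perm (Fin d) =>
    Bd.prod hb hδ (zero_le_one.trans hCM) Finset.univ (fun i z => M z (σ i) i) (fun i => hE _ _)
  have hS := Bd.sum Finset.univ (fun σ : Equiv.Perm (Fin d) => ((Equiv.Perm.sign σ : ℤ) : ℝ))
    (fun σ => by
      rcases Int.units_eq_one_or (Equiv.Perm.sign σ) with h | h <;> simp [h])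
    _ hP
  have hdet : (fun z => (M z).det) = fun z => ∑ σ : Equiv.Perm (Fin d),
      ((Equiv.Perm.sign σ : ℤ) : ℝ) * ∏ i, M z (σ i) i := by
    funext z
    exact Matrix.det_apply' _
  rw [hdet]
  refine (hS.2 ν y).trans (le_of_eq ?_)
  simp only [Finset.card_univ, Fintype.card_perm, Fintype.card_fin, wt]
  ring
end

section
/- Let s ≥ 1, let λ and ν be nonzero multi-indices with |λ| ≤ |ν|, let k_1, …, k_s be multi-indices with |k_j| > 0 for every j and Σ_{j=1}^s k_j = λ, and let ℓ_1, …, ℓ_s be nonzero multi-indices with Σ_{j=1}^s |k_j| · ℓ_j = ν (componentwise). Then for every real ω ≥ 0, (|λ|!)^ω · Π_{j=1}^s (|ℓ_j|!)^{ω·|k_j|} ≤ (|ν|!)^ω, the exponents being real powers. -/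
theorem aux_one (N l : ℕ) (hl : 1 ≤ l) :
    (N + 1).factorial * l.factorial ≤ (N + l).factorial := by
  induction l, hl using Nat.le_induction with
  | base => simp
  | succ m hm ih =>
    rw [← Nat.add_assoc, Nat.factorial_succ (N + m), Nat.factorial_succ m]
    calc (N + 1).factorial * ((m + 1) * m.factorial)
        = (m + 1) * ((N + 1).factorial * m.factorial) := by ring
      _ ≤ (N + m + 1) * (N + m).factorial := Nat.mul_le_mul (by omega) ih

theorem aux_rep (A N P l k : ℕ) (hl : 1 ≤ l) (hAN : A ≤ N)
    (h : A.factorial * P ≤ N.factorial) :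
    (A + k).factorial * (P * l.factorial ^ k) ≤ (N + k * l).factorial := by
  induction k with
  | zero => simpa using h
  | succ k ih =>
    have h1 : A + k ≤ N + k * l := by nlinarith
    have h2 := aux_one (N + k * l) l hl
    have h3 : N + (k + 1) * l = N + k * l + l := by ring
    rw [h3, ← Nat.add_assoc, Nat.factorial_succ, pow_succ]
    refine le_trans ?_ h2
    rw [Nat.factorial_succ (N + k * l)]
    calc (A + k + 1) * (A + k).factorial * (P * (l.factorial ^ k * l.factorial))
        = (A + k + 1) * ((A + k).factorial * (P * l.factorial ^ k)) * l.factorial := by ring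
      _ ≤ _ := Nat.mul_le_mul_right _ (Nat.mul_le_mul (by omega) ih)

theorem aux_sum {ι : Type*} (S : Finset ι) (k l : ι → ℕ) (hl : ∀ j, 1 ≤ l j) :
    (∑ j ∈ S, k j).factorial * ∏ j ∈ S, (l j).factorial ^ k j
      ≤ (∑ j ∈ S, k j * l j).factorial := by
  classical
  induction S using Finset.induction_on with
  | empty => simp
  | insert a S ha ih =>
    rw [Finset.sum_insert ha, Finset.sum_insert ha, Finset.prod_insert ha,
      add_comm (k a), add_comm (k a * l a), mul_comm (_ ^ k a)]
    exact aux_rep _ _ _ _ _ (hl a)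
      (Finset.sum_le_sum fun j _ => Nat.le_mul_of_pos_right _ (hl j)) ih

theorem deg_eq_degree (ν : ℕ →₀ ℕ) : deg ν = Finsupp.degree ν := rfl

theorem stmt14 (s : ℕ) (hs : 1 ≤ s) (lam ν : ℕ →₀ ℕ) (hlam : lam ≠ 0) (hν : ν ≠ 0)
    (hdeg : deg lam ≤ deg ν)
    (k : Fin s → (ℕ →₀ ℕ)) (hk : ∀ j, 0 < deg (k j)) (hksum : ∑ j, k j = lam)
    (l : Fin s → (ℕ →₀ ℕ)) (hl : ∀ j, l j ≠ 0) (hlsum : ∑ j, deg (k j) • l j = ν)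
    (ω : ℝ) (hω : 0 ≤ ω) :
    ((deg lam).factorial : ℝ) ^ ω *
        ∏ j, ((deg (l j)).factorial : ℝ) ^ (ω * (deg (k j) : ℝ))
      ≤ ((deg ν).factorial : ℝ) ^ ω := by
  have h1 : deg lam = ∑ j, deg (k j) := by
    simp only [deg_eq_degree, ← hksum, map_sum]
  have h2 : deg ν = ∑ j, deg (k j) * deg (l j) := by
    simp only [← hlsum, deg_eq_degree, map_sum, map_nsmul, smul_eq_mul]
  have hl1 : ∀ j, 1 ≤ deg (l j) := by
    intro j
    rw [Nat.one_le_iff_ne_zero, deg_eq_degree, Ne, Finsupp.degree_eq_zero_iff]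
    exact hl j
  have key := aux_sum Finset.univ (fun j => deg (k j)) (fun j => deg (l j)) hl1
  rw [← h1, ← h2] at key
  have key' : ((deg lam).factorial : ℝ) * ∏ j, ((deg (l j)).factorial : ℝ) ^ deg (k j)
      ≤ ((deg ν).factorial : ℝ) := by exact_mod_cast key
  have h3 : ∏ j, ((deg (l j)).factorial : ℝ) ^ (ω * (deg (k j) : ℝ))
      = (∏ j, ((deg (l j)).factorial : ℝ) ^ deg (k j)) ^ ω := by
    rw [← Real.finsetProd_rpow _ _ (fun j _ => by positivity)]
    refine Finset.prod_congr rfl fun j _ => ?_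
    rw [mul_comm, Real.rpow_mul (by positivity), Real.rpow_natCast]
  rw [h3, ← Real.mul_rpow (by positivity) (Finset.prod_nonneg fun j _ => by positivity)]
  exact Real.rpow_le_rpow (mul_nonneg (by positivity)
    (Finset.prod_nonneg fun j _ => by positivity)) key' hω
end
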